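/- Let q > 2 be an integer. For every integer m ≥ 6, F_m^(0) ≤ 2·F_{m−1}^(0) + ((q+1)(q−2)/2)·F_{m−2}^(0) + (q(q−1)(q−2)/3)·F_{m−3}^(0). -/

import Mathlib

/-- F_m⁽⁰⁾: the number of q-ary strings of length m containing no index i with
α_i > α_{i+1} > α_{i+2}. -/
noncomputable def F0 (q m : ℕ) : ℕ :=
  {α : Fin m → Fin q | ¬ ∃ i : ℕ, ∃ h : i + 2 < m,
    α ⟨i + 1, by omega⟩ < α ⟨i, by omega⟩ ∧ α ⟨i + 2, h⟩ < α ⟨i + 1, by omega⟩}.ncard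

open Finset

/-- The strings of length `m` over `Fin q` without two consecutive strict descents. -/
noncomputable def noDoubleDescent (q m : ℕ) : Finset (Fin m → Fin q) :=
  Set.Finite.toFinset (s := {α : Fin m → Fin q | ¬ ∃ i : ℕ, ∃ h : i + 2 < m,
    α ⟨i + 1, by omega⟩ < α ⟨i, by omega⟩ ∧ α ⟨i + 2, h⟩ < α ⟨i + 1, by omega⟩})
    (Set.toFinite _)

theorem card_noDoubleDescent (q m : ℕ) : (noDoubleDescent q m).card = F0 q m :=
  (Set.ncard_eq_toFinset_card _ _).symm

theorem tail_mem_noDoubleDescent {q m : ℕ} {α : Fin (m + 1) → Fin q}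
    (hα : α ∈ noDoubleDescent q (m + 1)) : Fin.tail α ∈ noDoubleDescent q m := by
  simp only [noDoubleDescent, Set.Finite.mem_toFinset, Set.mem_ofPred_eq] at hα ⊢
  rintro ⟨i, h, h₁, h₂⟩
  exact hα ⟨i + 1, by omega, h₁, h₂⟩

theorem not_double_descent_start {q m : ℕ} {α : Fin (m + 3) → Fin q}
    (hα : α ∈ noDoubleDescent q (m + 3)) (h : α 1 < α 0) : α 1 ≤ α 2 := by
  simp only [noDoubleDescent, Set.Finite.mem_toFinset, Set.mem_ofPred_eq] at hα
  by_contra! hlt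
  exact hα ⟨0, by omega, h, hlt⟩

/-- Pairs `(a, b)` with `2 ≤ a` and either `b = 0` or `a ≤ b`. -/
def ascentPairs (k : ℕ) : Finset (Σ _ : Fin (k + 3), Fin (k + 3)) :=
  (univ.filter fun a : Fin (k + 3) => 2 ≤ a.val).sigma fun a => insert 0 (Ici a)

/-- Triples `(b, a, c)` with `1 ≤ b`, `b < a` and `b ≤ c`. -/
def valleyTriples (k : ℕ) : Finset (Σ _ : Fin (k + 3), Fin (k + 3) × Fin (k + 3)) :=
  (univ.filter fun b : Fin (k + 3) => 1 ≤ b.val).sigma fun b => Ioi b ×ˢ Ici b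

theorem card_ascentPairs (k : ℕ) : 2 * (ascentPairs k).card = (k + 4) * (k + 1) := by
  have h : (ascentPairs k).card = ∑ i ∈ range (k + 1), (i + 2) := by
    rw [ascentPairs, card_sigma, ← sum_range_reflect,
      ← Fin.sum_univ_eq_sum_range (fun i => k + 1 - 1 - i + 2), sum_filter,
      Fin.sum_univ_succ, Fin.sum_univ_succ]
    simp only [Fin.val_zero, Fin.val_succ]
    simp only [show ¬ 2 ≤ 0 by omega, show ¬ 2 ≤ 0 + 1 by omega, if_false, zero_add]
    refine sum_congr rfl fun i _ => ?_
    rw [if_pos (by omega), card_insert_of_notMem, Fin.card_Ici]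
    · simp only [Fin.val_succ]; omega
    · simp
  rw [h]
  clear h
  induction k with
  | zero => simp
  | succ k ih => rw [sum_range_succ, mul_add, ih]; ring

theorem card_valleyTriples (k : ℕ) :
    3 * (valleyTriples k).card = (k + 3) * (k + 2) * (k + 1) := by
  have h : (valleyTriples k).card = ∑ i ∈ range (k + 2), i * (i + 1) := by
    rw [valleyTriples, card_sigma, ← sum_range_reflect,
      ← Fin.sum_univ_eq_sum_range (fun i => (k + 2 - 1 - i) * (k + 2 - 1 - i + 1)), sum_filter,
      Fin.sum_univ_succ]
    simp only [Fin.val_zero, Fin.val_succ]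
    simp only [show ¬ 1 ≤ 0 by omega, if_false, zero_add]
    refine sum_congr rfl fun i _ => ?_
    rw [if_pos (by omega), card_product, Fin.card_Ioi, Fin.card_Ici]
    simp only [Fin.val_succ]
    congr 1 <;> omega
  rw [h]
  clear h
  induction k with
  | zero => simp [sum_range_succ]
  | succ k ih => rw [sum_range_succ, mul_add, ih]; ring

theorem F0_add_three_le (k n : ℕ) :
    F0 (k + 3) (n + 3) ≤ 2 * F0 (k + 3) (n + 2) + (ascentPairs k).card * F0 (k + 3) (n + 1)
      + (valleyTriples k).card * F0 (k + 3) n := by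
  classical
  simp only [← card_noDoubleDescent]
  set S := noDoubleDescent (k + 3) (n + 3)
  let isLow : (Fin (n + 3) → Fin (k + 3)) → Prop := fun α => (α 0).val < 2
  let isPair : (Fin (n + 3) → Fin (k + 3)) → Prop := fun α => α 1 = 0 ∨ α 0 ≤ α 1
  have low : (S.filter isLow).card ≤ 2 * (noDoubleDescent (k + 3) (n + 2)).card := by
    suffices (S.filter isLow).card ≤ (range 2 ×ˢ noDoubleDescent (k + 3) (n + 2)).card by
      rwa [card_product, card_range] at this
    refine card_le_card_of_injOn (fun α => ((α 0).val, Fin.tail α)) ?_ ?_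
    · intro α hα
      obtain ⟨hS, hlow⟩ := mem_filter.1 hα
      exact mem_product.2 ⟨mem_range.2 hlow, tail_mem_noDoubleDescent hS⟩
    · intro α _ β _ h
      obtain ⟨h₀, ht⟩ := Prod.mk.inj h
      rw [← Fin.cons_self_tail α, ← Fin.cons_self_tail β, ht, Fin.ext h₀]
  have pair : ((S.filter (¬ isLow ·)).filter isPair).card
      ≤ (ascentPairs k).card * (noDoubleDescent (k + 3) (n + 1)).card := by
    rw [← card_product]
    refine card_le_card_of_injOn (fun α => (⟨α 0, α 1⟩, Fin.tail (Fin.tail α))) ?_ ?_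
    · intro α hα
      simp only [coe_filter, mem_filter, Set.mem_ofPred_eq, isLow, isPair] at hα
      obtain ⟨⟨hS, hlow⟩, hpair⟩ := hα
      refine mem_product.2 ⟨?_, tail_mem_noDoubleDescent (tail_mem_noDoubleDescent hS)⟩
      simpa [ascentPairs] using ⟨not_lt.1 hlow, hpair⟩
    · intro α _ β _ h
      simp only [Prod.mk.injEq, Sigma.mk.injEq, heq_eq_eq] at h
      obtain ⟨⟨h₀, h₁⟩, ht⟩ := h
      funext i
      refine Fin.cases h₀ (fun i => Fin.cases h₁ (fun i => congrFun ht i) i) i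
  have valley : ((S.filter (¬ isLow ·)).filter (¬ isPair ·)).card
      ≤ (valleyTriples k).card * (noDoubleDescent (k + 3) n).card := by
    rw [← card_product]
    refine card_le_card_of_injOn
      (fun α => (⟨α 1, (α 0, α 2)⟩, Fin.tail (Fin.tail (Fin.tail α)))) ?_ ?_
    · intro α hα
      simp only [coe_filter, mem_filter, Set.mem_ofPred_eq, isPair, not_or, not_le] at hα
      obtain ⟨⟨hS, -⟩, hne, hlt⟩ := hα
      refine mem_product.2 ⟨?_, tail_mem_noDoubleDescent
        (tail_mem_noDoubleDescent (tail_mem_noDoubleDescent hS))⟩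
      have hpos : 1 ≤ (α 1).val := Nat.one_le_iff_ne_zero.2 fun h => hne (Fin.ext h)
      simp only [valleyTriples, mem_sigma, mem_filter, mem_univ, true_and, mem_product, mem_Ioi,
        mem_Ici]
      exact ⟨hpos, hlt, not_double_descent_start hS hlt⟩
    · intro α _ β _ h
      simp only [Prod.mk.injEq, Sigma.mk.injEq, heq_eq_eq] at h
      obtain ⟨⟨h₁, h₀, h₂⟩, ht⟩ := h
      funext i
      refine Fin.cases h₀ (fun i => Fin.cases h₁ (fun i => Fin.cases h₂
        (fun i => congrFun ht i) i) i) i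
  have split₁ := card_filter_add_card_filter_not (s := S) isLow
  have split₂ := card_filter_add_card_filter_not (s := S.filter (¬ isLow ·)) isPair
  omega

/-- the recursion F_m⁽⁰⁾ ≤ 2F_{m−1}⁽⁰⁾ + ((q+1)(q−2)/2)F_{m−2}⁽⁰⁾
+ (q(q−1)(q−2)/3)F_{m−3}⁽⁰⁾ for m ≥ 6 and q > 2. -/
theorem stmt13 (q m : ℕ) (hq : 2 < q) (hm : 6 ≤ m) :
    (F0 q m : ℝ) ≤ 2 * (F0 q (m - 1) : ℝ)
      + (((q : ℝ) + 1) * ((q : ℝ) - 2) / 2) * (F0 q (m - 2) : ℝ)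
      + ((q : ℝ) * ((q : ℝ) - 1) * ((q : ℝ) - 2) / 3) * (F0 q (m - 3) : ℝ) := by
  obtain ⟨k, rfl⟩ : ∃ k, q = k + 3 := ⟨q - 3, by omega⟩
  obtain ⟨n, rfl⟩ : ∃ n, m = n + 3 := ⟨m - 3, by omega⟩
  have hpairs : (((k + 3 : ℕ) : ℝ) + 1) * (((k + 3 : ℕ) : ℝ) - 2) / 2 = (ascentPairs k).card := by
    have h : (2 : ℝ) * (ascentPairs k).card = (k + 4) * (k + 1) := by
      exact_mod_cast card_ascentPairs k
    push_cast
    linarith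
  have htriples : ((k + 3 : ℕ) : ℝ) * (((k + 3 : ℕ) : ℝ) - 1) * (((k + 3 : ℕ) : ℝ) - 2) / 3
      = (valleyTriples k).card := by
    have h : (3 : ℝ) * (valleyTriples k).card = (k + 3) * (k + 2) * (k + 1) := by
      exact_mod_cast card_valleyTriples k
    push_cast
    linarith
  rw [hpairs, htriples]
  exact_mod_cast F0_add_three_le k n
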